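/- arXiv:2209.10522 — 2 statements merged into one kernel-verified Lean document; each statement's English description precedes it below -/
import Mathlib

section
/- (Lemma 2) With G as defined below and Λ the von Mangoldt function, Σ_{n=1}^∞ (Λ(n)/√n)(G(log n) + G(−log n)) = Σ_{n=1}^∞ Λ(n) α(n) β(1/n) + Σ_{n=1}^∞ (Λ(n)/n) α(1/n) β(n), all series converging absolutely. -/
open scoped Real
open Real

noncomputable section

/-- `a(2^l * m) = 2^l * σ₁(m)` for `m` odd; in particular `a(n) = σ₁(n)` for odd `n`. -/
def paperA (n : ℕ) : ℤ :=
  2 ^ (n.factorization 2) * (ArithmeticFunction.sigma 1 (ordCompl[2] n) : ℤ)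

/-- `b(n) = σ₁(n)` for odd `n`, `b(n) = 0` for even `n`. -/
def paperB (n : ℕ) : ℤ :=
  if Odd n then (ArithmeticFunction.sigma 1 n : ℤ) else 0

/-- `α(u) = Σ_{k≥1} a(k) e^{−π k u}`. -/
def alphaFn (u : ℝ) : ℝ := ∑' k : ℕ, (paperA k : ℝ) * Real.exp (-(π * k * u))

/-- `β(u) = Σ_{l≥1} b(l) e^{−π l u}`. -/
def betaFn (u : ℝ) : ℝ := ∑' l : ℕ, (paperB l : ℝ) * Real.exp (-(π * l * u))

/-- `g(v, x) = e^{v/2} exp(−(x/2)(e^v + e^{−v}))`. -/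
def paperg (v x : ℝ) : ℝ :=
  Real.exp (v / 2) * Real.exp (-(x / 2) * (Real.exp v + Real.exp (-v)))

/-- `G(v) = Σ_{j≥1} Σ_{d∣j} a(d) b(j/d) (j/d²)^{1/4} g(v − (1/2)log(j/d²), 2π√j)`. -/
def paperG (v : ℝ) : ℝ :=
  ∑' j : ℕ, ∑ d ∈ j.divisors,
    (paperA d : ℝ) * (paperB (j / d) : ℝ) * ((j : ℝ) / (d : ℝ) ^ 2) ^ ((1 : ℝ) / 4) *
      paperg (v - (1 / 2) * Real.log ((j : ℝ) / (d : ℝ) ^ 2)) (2 * π * Real.sqrt j)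

theorem paperA_nonneg (n : ℕ) : 0 ≤ paperA n := by
  unfold paperA
  positivity

theorem paperB_nonneg (n : ℕ) : 0 ≤ paperB n := by
  unfold paperB
  split_ifs <;> positivity

theorem paperA_zero : paperA 0 = 0 := by simp [paperA]

theorem paperB_zero : paperB 0 = 0 := by simp [paperB]

theorem sigma_one_le_sq (n : ℕ) : ArithmeticFunction.sigma 1 n ≤ n ^ 2 := by
  rw [ArithmeticFunction.sigma_one_apply, sq]
  calc ∑ d ∈ n.divisors, d ≤ n.divisors.card • n :=
        Finset.sum_le_card_nsmul _ _ _ fun d hd => Nat.divisor_le hd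
    _ ≤ n * n := by
        rw [smul_eq_mul]
        exact Nat.mul_le_mul_right _ (Nat.card_divisors_le_self n)

theorem paperA_le_sq (n : ℕ) : paperA n ≤ (n : ℤ) ^ 2 := by
  have h : 2 ^ n.factorization 2 * ArithmeticFunction.sigma 1 (ordCompl[2] n) ≤ n ^ 2 := by
    calc 2 ^ n.factorization 2 * ArithmeticFunction.sigma 1 (ordCompl[2] n)
        ≤ (2 ^ n.factorization 2) ^ 2 * (ordCompl[2] n) ^ 2 := by
          exact Nat.mul_le_mul (Nat.le_self_pow two_ne_zero _) (sigma_one_le_sq _)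
      _ = n ^ 2 := by rw [← mul_pow, Nat.ordProj_mul_ordCompl_eq_self]
  unfold paperA
  exact_mod_cast h

theorem paperB_le_sq (n : ℕ) : paperB n ≤ (n : ℤ) ^ 2 := by
  unfold paperB
  split_ifs
  · exact_mod_cast sigma_one_le_sq n
  · positivity

theorem mul_exp_le {f : ℕ → ℤ} (hf : ∀ n, f n ≤ (n : ℤ) ^ 2) {m : ℕ} (hm : 4 ≤ m) {u : ℝ}
    (hu : 0 < u) (k : ℕ) :
    (f k : ℝ) * Real.exp (-(π * k * u)) ≤ m.factorial / u ^ m * (1 / (k : ℝ) ^ 2) := by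
  have hfk : (f k : ℝ) ≤ (k : ℝ) ^ 2 := by exact_mod_cast hf k
  rcases Nat.eq_zero_or_pos k with rfl | hk
  · simpa using hfk
  have hk1 : (1 : ℝ) ≤ k := by exact_mod_cast hk
  have hexp : Real.exp (-(π * k * u)) ≤ m.factorial / (k * u) ^ m := by
    rw [Real.exp_neg, ← inv_div]
    refine inv_anti₀ (by positivity) ((Real.pow_div_factorial_le_exp _ (by positivity) m).trans ?_)
    rw [Real.exp_le_exp, mul_assoc]
    exact le_mul_of_one_le_left (by positivity) (by linarith [Real.pi_gt_three])
  calc (f k : ℝ) * Real.exp (-(π * k * u)) ≤ (k : ℝ) ^ 2 * (m.factorial / (k * u) ^ m) := by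
        gcongr
    _ = m.factorial / u ^ m * ((k : ℝ) ^ 2 / (k : ℝ) ^ m) := by rw [mul_pow]; field_simp
    _ ≤ m.factorial / u ^ m * (1 / (k : ℝ) ^ 2) := by
        refine mul_le_mul_of_nonneg_left ?_ (by positivity)
        rw [div_le_div_iff₀ (by positivity) (by positivity), one_mul, ← pow_add]
        exact pow_le_pow_right₀ hk1 hm

theorem summable_mul_exp {f : ℕ → ℤ} (hf : ∀ n, 0 ≤ f n) (hf' : ∀ n, f n ≤ (n : ℤ) ^ 2) {u : ℝ}
    (hu : 0 < u) : Summable fun k : ℕ => (f k : ℝ) * Real.exp (-(π * k * u)) := by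
  refine Summable.of_nonneg_of_le (fun k => ?_) (fun k => mul_exp_le hf' le_rfl hu k)
    ((Real.summable_one_div_nat_pow.2 one_lt_two).mul_left _)
  have : (0 : ℝ) ≤ f k := by exact_mod_cast hf k
  positivity

theorem tsum_mul_exp_le {f : ℕ → ℤ} (hf : ∀ n, 0 ≤ f n) (hf' : ∀ n, f n ≤ (n : ℤ) ^ 2) {m : ℕ}
    (hm : 4 ≤ m) {u : ℝ} (hu : 0 < u) :
    ∑' k : ℕ, (f k : ℝ) * Real.exp (-(π * k * u)) ≤
      m.factorial / u ^ m * ∑' k : ℕ, 1 / (k : ℝ) ^ 2 := by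
  rw [← tsum_mul_left]
  exact (summable_mul_exp hf hf' hu).tsum_le_tsum (fun k => mul_exp_le hf' hm hu k)
    ((Real.summable_one_div_nat_pow.2 one_lt_two).mul_left _)

theorem alphaFn_nonneg (u : ℝ) : 0 ≤ alphaFn u :=
  tsum_nonneg fun k => mul_nonneg (by exact_mod_cast paperA_nonneg k) (Real.exp_nonneg _)

theorem betaFn_nonneg (u : ℝ) : 0 ≤ betaFn u :=
  tsum_nonneg fun k => mul_nonneg (by exact_mod_cast paperB_nonneg k) (Real.exp_nonneg _)

/-- The Dirichlet convolution form of the product of two absolutely convergent series. -/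
theorem tsum_mul_tsum_eq_tsum_sum_divisors {f g : ℕ → ℝ} (hf : Summable fun n => ‖f n‖)
    (hg : Summable fun n => ‖g n‖) (hf0 : f 0 = 0) (hg0 : g 0 = 0) :
    (∑' n, f n) * ∑' n, g n = ∑' j : ℕ, ∑ d ∈ j.divisors, f d * g (j / d) := by
  rw [tsum_mul_tsum_of_summable_norm hf hg]
  have hs : Summable fun p : ℕ × ℕ => f p.1 * g p.2 := summable_mul_of_summable_norm hf hg
  rw [← (hs.hasSum.tsum_fiberwise fun p : ℕ × ℕ => p.1 * p.2).tsum_eq]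
  refine tsum_congr fun j => ?_
  rw [← Nat.sum_divisorsAntidiagonal fun x y => f x * g y]
  rcases eq_or_ne j 0 with rfl | hj
  · rw [Nat.divisorsAntidiagonal_zero, Finset.sum_empty]
    convert tsum_zero with p
    obtain ⟨⟨x, y⟩, hp⟩ := p
    rcases Nat.mul_eq_zero.1 (show x * y = 0 from hp) with rfl | rfl
    · simp [hf0]
    · simp [hg0]
  · have : (fun p : ℕ × ℕ => p.1 * p.2) ⁻¹' {j} = ↑j.divisorsAntidiagonal := by
      ext p
      simp [hj]
    rw [this]
    exact Finset.tsum_subtype j.divisorsAntidiagonal fun p : ℕ × ℕ => f p.1 * g p.2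

theorem rpow_mul_paperg {k l : ℝ} (hk : 0 < k) (hl : 0 < l) (v : ℝ) :
    (l / k) ^ ((1 : ℝ) / 4) *
        paperg (v - (1 / 2) * Real.log (l / k)) (2 * π * Real.sqrt (k * l)) =
      Real.exp (v / 2) * (Real.exp (-(π * k * Real.exp v)) *
        Real.exp (-(π * l * Real.exp (-v)))) := by
  have hlk : 0 < l / k := by positivity
  have hs : Real.exp ((1 / 2) * Real.log (l / k)) = √l / √k := by
    rw [← Real.sqrt_div hl.le, Real.sqrt_eq_rpow, Real.rpow_def_of_pos hlk, mul_comm]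
  have hk' : √k * √k = k := Real.mul_self_sqrt hk.le
  have hl' : √l * √l = l := Real.mul_self_sqrt hl.le
  have hk0 : 0 < √k := Real.sqrt_pos.2 hk
  have hl0 : 0 < √l := Real.sqrt_pos.2 hl
  have h₁ : √k * √l * (Real.exp v / (√l / √k)) = k * Real.exp v := by
    field_simp
    rw [sq, hk']
  have h₂ : √k * √l * (Real.exp (-v) * (√l / √k)) = l * Real.exp (-v) := by
    field_simp
    rw [sq, hl']
  have he : -(2 * π * √(k * l) / 2) * (Real.exp (v - (1 / 2) * Real.log (l / k)) +
      Real.exp (-(v - (1 / 2) * Real.log (l / k)))) =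
      -(π * k * Real.exp v) + -(π * l * Real.exp (-v)) := by
    rw [neg_sub, sub_eq_neg_add _ v, Real.exp_sub, Real.exp_add, hs, Real.sqrt_mul hk.le]
    linear_combination -π * h₁ - π * h₂
  rw [paperg, he, Real.rpow_def_of_pos hlk, ← Real.exp_add, ← Real.exp_add, ← Real.exp_add,
    ← Real.exp_add]
  congr 1
  ring

theorem paperG_eq (v : ℝ) :
    paperG v = Real.exp (v / 2) * (alphaFn (Real.exp v) * betaFn (Real.exp (-v))) := by
  have ha := summable_mul_exp paperA_nonneg paperA_le_sq (Real.exp_pos v)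
  have hb := summable_mul_exp paperB_nonneg paperB_le_sq (Real.exp_pos (-v))
  rw [alphaFn, betaFn, tsum_mul_tsum_eq_tsum_sum_divisors ha.norm hb.norm (by simp [paperA_zero])
    (by simp [paperB_zero]), ← tsum_mul_left, paperG]
  refine tsum_congr fun j => ?_
  rw [Finset.mul_sum]
  refine Finset.sum_congr rfl fun d hd => ?_
  obtain ⟨⟨l, rfl⟩, hj⟩ := Nat.mem_divisors.1 hd
  have hd0 : 0 < d := Nat.pos_of_ne_zero (left_ne_zero_of_mul hj)
  have hl0 : 0 < l := Nat.pos_of_ne_zero (right_ne_zero_of_mul hj)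
  have hd' : (0 : ℝ) < d := by exact_mod_cast hd0
  have hquot : ((d * l : ℕ) : ℝ) / (d : ℝ) ^ 2 = l / d := by
    push_cast
    field_simp
  rw [Nat.mul_div_cancel_left l hd0, hquot, Nat.cast_mul, mul_assoc,
    rpow_mul_paperg hd' (by exact_mod_cast hl0)]
  ring

theorem paperG_log {x : ℝ} (hx : 0 < x) :
    paperG (Real.log x) = √x * (alphaFn x * betaFn (1 / x)) := by
  rw [paperG_eq, Real.exp_half, Real.exp_neg, Real.exp_log hx, one_div]

theorem vonMangoldt_le_self (n : ℕ) : ArithmeticFunction.vonMangoldt n ≤ n :=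
  ArithmeticFunction.vonMangoldt_le_log.trans (Real.log_le_self n.cast_nonneg)

/-- Super-polynomial decay of one factor beats polynomial growth of the other. -/
theorem summable_mul_of_le_pow {w f g : ℕ → ℝ} {C D : ℝ} (hw : ∀ n, 0 ≤ w n)
    (hw' : ∀ n, w n ≤ n) (hf : ∀ n, 0 ≤ f n) (hg : ∀ n, 0 ≤ g n)
    (hfC : ∀ n : ℕ, 0 < n → f n ≤ C / (n : ℝ) ^ 8)
    (hgD : ∀ n : ℕ, 0 < n → g n ≤ D * (n : ℝ) ^ 4) :
    Summable fun n => w n * (f n * g n) := by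
  refine Summable.of_nonneg_of_le (fun n => mul_nonneg (hw n) (mul_nonneg (hf n) (hg n)))
    (fun n => ?_) ((Real.summable_one_div_nat_pow.2 (show 1 < 3 by norm_num)).mul_left (C * D))
  rcases Nat.eq_zero_or_pos n with rfl | hn
  · have : w 0 = 0 := le_antisymm (by simpa using hw' 0) (hw 0)
    simp [this]
  have hn' : (0 : ℝ) < n := by exact_mod_cast hn
  calc w n * (f n * g n) ≤ n * (C / (n : ℝ) ^ 8 * (D * (n : ℝ) ^ 4)) := by
        have := (hf n).trans (hfC n hn)
        gcongr
        exacts [mul_nonneg (hf n) (hg n), hw' n, hg n, hfC n hn, hgD n hn]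
    _ = C * D * (1 / (n : ℝ) ^ 3) := by field_simp

theorem summable_vonMangoldt_alphaFn_betaFn :
    Summable fun n : ℕ => ArithmeticFunction.vonMangoldt n * alphaFn n * betaFn (1 / n) := by
  simp_rw [mul_assoc]
  refine summable_mul_of_le_pow (C := Nat.factorial 8 * ∑' k : ℕ, 1 / (k : ℝ) ^ 2)
    (D := Nat.factorial 4 * ∑' k : ℕ, 1 / (k : ℝ) ^ 2)
    (fun _ => ArithmeticFunction.vonMangoldt_nonneg) vonMangoldt_le_self
    (fun _ => alphaFn_nonneg _) (fun _ => betaFn_nonneg _) (fun n hn => ?_) (fun n hn => ?_)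
  all_goals have hn' : (0 : ℝ) < n := by exact_mod_cast hn
  · refine (tsum_mul_exp_le paperA_nonneg paperA_le_sq (show 4 ≤ 8 by norm_num) hn').trans_eq ?_
    ring
  · refine (tsum_mul_exp_le paperB_nonneg paperB_le_sq le_rfl (one_div_pos.2 hn')).trans_eq ?_
    rw [one_div_pow, div_div_eq_mul_div]
    ring

theorem summable_vonMangoldt_div_alphaFn_betaFn :
    Summable fun n : ℕ => ArithmeticFunction.vonMangoldt n / n * alphaFn (1 / n) * betaFn n := by
  simp_rw [mul_assoc, mul_comm (alphaFn _)]
  refine summable_mul_of_le_pow (C := Nat.factorial 8 * ∑' k : ℕ, 1 / (k : ℝ) ^ 2)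
    (D := Nat.factorial 4 * ∑' k : ℕ, 1 / (k : ℝ) ^ 2)
    (fun n => div_nonneg ArithmeticFunction.vonMangoldt_nonneg n.cast_nonneg) (fun n => ?_)
    (fun _ => betaFn_nonneg _) (fun _ => alphaFn_nonneg _) (fun n hn => ?_) (fun n hn => ?_)
  · rcases Nat.eq_zero_or_pos n with rfl | hn
    · simp
    · exact (div_le_self ArithmeticFunction.vonMangoldt_nonneg (by exact_mod_cast hn)).trans
        (vonMangoldt_le_self n)
  all_goals have hn' : (0 : ℝ) < n := by exact_mod_cast hn
  · refine (tsum_mul_exp_le paperB_nonneg paperB_le_sq (show 4 ≤ 8 by norm_num) hn').trans_eq ?_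
    ring
  · refine (tsum_mul_exp_le paperA_nonneg paperA_le_sq le_rfl (one_div_pos.2 hn')).trans_eq ?_
    rw [one_div_pow, div_div_eq_mul_div]
    ring

theorem vonMangoldt_mul_paperG_add (n : ℕ) :
    (ArithmeticFunction.vonMangoldt n / √n) * (paperG (Real.log n) + paperG (-Real.log n)) =
      ArithmeticFunction.vonMangoldt n * alphaFn n * betaFn (1 / n) +
        (ArithmeticFunction.vonMangoldt n / n) * alphaFn (1 / n) * betaFn n := by
  rcases Nat.eq_zero_or_pos n with rfl | hn
  · simp
  have hn' : (0 : ℝ) < n := by exact_mod_cast hn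
  have hs : 0 < √(n : ℝ) := Real.sqrt_pos.2 hn'
  have hsq : √(n : ℝ) ^ 2 = n := Real.sq_sqrt hn'.le
  rw [← Real.log_inv, paperG_log hn', paperG_log (inv_pos.2 hn'), Real.sqrt_inv, one_div, one_div,
    inv_inv]
  generalize √(n : ℝ) = s at hs hsq
  generalize alphaFn n = p
  generalize alphaFn (n : ℝ)⁻¹ = q
  generalize betaFn n = p'
  generalize betaFn (n : ℝ)⁻¹ = q'
  rw [← hsq]
  field_simp

open ArithmeticFunction in
theorem lemma_two :
    Summable (fun n : ℕ =>
      |(vonMangoldt n / Real.sqrt n) * (paperG (Real.log n) + paperG (-Real.log n))|) ∧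
    Summable (fun n : ℕ => |vonMangoldt n * alphaFn n * betaFn (1 / n)|) ∧
    Summable (fun n : ℕ => |(vonMangoldt n / n) * alphaFn (1 / n) * betaFn n|) ∧
    ∑' n : ℕ, (vonMangoldt n / Real.sqrt n) * (paperG (Real.log n) + paperG (-Real.log n)) =
      ∑' n : ℕ, vonMangoldt n * alphaFn n * betaFn (1 / n) +
        ∑' n : ℕ, (vonMangoldt n / n) * alphaFn (1 / n) * betaFn n := by
  have h₁ := summable_vonMangoldt_alphaFn_betaFn
  have h₂ := summable_vonMangoldt_div_alphaFn_betaFn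
  simp_rw [vonMangoldt_mul_paperG_add]
  exact ⟨(h₁.add h₂).abs, h₁.abs, h₂.abs, h₁.tsum_add h₂⟩
end
end

section
/- The theta value at i is θ₃(i) = π^{1/4} / Γ(3/4); that is, Σ_{n∈ℤ} e^{−π n²} = π^{1/4} / Γ(3/4). -/
open scoped Real
open Real

open MeasureTheory Set Filter Topology

/-! ### Theta series on the imaginary axis -/

/-- The Jacobi theta function `θ₃` at `τ = i t`. -/
noncomputable def thetaThree (t : ℝ) : ℝ := ∑' n : ℤ, Real.exp (-(π * t * (n : ℝ) ^ 2))

/-- The Jacobi theta function `θ₄` at `τ = i t`. -/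
noncomputable def thetaFour (t : ℝ) : ℝ :=
  ∑' n : ℤ, (-1 : ℝ) ^ n * Real.exp (-(π * t * (n : ℝ) ^ 2))

lemma summable_exp_neg_mul_int_sq {t : ℝ} (ht : 0 < t) :
    Summable fun n : ℤ => Real.exp (-(π * t * (n : ℝ) ^ 2)) := by
  have h := ((summable_jacobiTheta₂_term_iff 0 (t * Complex.I)).2 (by simpa using ht)).norm
  refine h.congr fun n => ?_
  rw [norm_jacobiTheta₂_term]
  congr 1
  simp
  ring

lemma norm_neg_one_zpow_mul_exp (n : ℤ) (x : ℝ) :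
    ‖(-1 : ℝ) ^ n * Real.exp x‖ = Real.exp x := by
  rw [norm_mul, norm_zpow, norm_neg, norm_one, one_zpow, one_mul, Real.norm_eq_abs, Real.abs_exp]

lemma summable_neg_one_zpow_mul_exp {t : ℝ} (ht : 0 < t) :
    Summable fun n : ℤ => (-1 : ℝ) ^ n * Real.exp (-(π * t * (n : ℝ) ^ 2)) := by
  refine Summable.of_norm ?_
  simpa only [norm_neg_one_zpow_mul_exp] using summable_exp_neg_mul_int_sq ht

lemma thetaThree_pos {t : ℝ} (ht : 0 < t) : 0 < thetaThree t :=
  (summable_exp_neg_mul_int_sq ht).tsum_pos (fun _ => (Real.exp_pos _).le) 0 (Real.exp_pos _)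

/-- A series over `ℤ × ℤ` supported on pairs of equal parity, in the rotated coordinates. -/
lemma tsum_eq_tsum_add_sub (F : ℤ × ℤ → ℝ) (hF : ∀ p : ℤ × ℤ, Odd (p.1 + p.2) → F p = 0) :
    ∑' p, F p = ∑' p : ℤ × ℤ, F (p.1 + p.2, p.1 - p.2) := by
  have hinj : Function.Injective fun p : ℤ × ℤ => (p.1 + p.2, p.1 - p.2) := by
    rintro ⟨a, b⟩ ⟨c, d⟩ h
    simp only [Prod.mk.injEq] at h ⊢
    omega
  refine (hinj.tsum_eq (f := F) ?_).symm
  rintro ⟨m, n⟩ h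
  have hev : Even (m + n) := by
    by_contra hc
    exact h (hF (m, n) (Int.not_even_iff_odd.1 hc))
  obtain ⟨k, hk⟩ := hev
  exact ⟨(k, m - k), by simp only [Prod.mk.injEq]; omega⟩

lemma thetaThree_sq_add_thetaFour_sq {t : ℝ} (ht : 0 < t) :
    thetaThree t ^ 2 + thetaFour t ^ 2 = 2 * thetaThree (2 * t) ^ 2 := by
  have h3 := summable_exp_neg_mul_int_sq ht
  have h4 := summable_neg_one_zpow_mul_exp ht
  have h32 := summable_exp_neg_mul_int_sq (t := 2 * t) (by positivity)
  simp only [sq (thetaThree _), sq (thetaFour _)]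
  simp only [thetaThree, thetaFour]
  rw [tsum_mul_tsum_of_summable_norm h3.norm h3.norm,
    tsum_mul_tsum_of_summable_norm h4.norm h4.norm,
    tsum_mul_tsum_of_summable_norm h32.norm h32.norm,
    ← (summable_mul_of_summable_norm h3.norm h3.norm).tsum_add
      (summable_mul_of_summable_norm h4.norm h4.norm), ← tsum_mul_left, tsum_eq_tsum_add_sub]
  · refine tsum_congr fun ⟨a, b⟩ => ?_
    have hs : (-1 : ℝ) ^ (a + b) * (-1 : ℝ) ^ (a - b) = 1 := by
      rw [← zpow_add₀ (by norm_num)]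
      exact Even.neg_one_zpow ⟨a, by ring⟩
    have he : Real.exp (-(π * t * ((a + b : ℤ) : ℝ) ^ 2)) *
        Real.exp (-(π * t * ((a - b : ℤ) : ℝ) ^ 2)) =
        Real.exp (-(π * (2 * t) * (a : ℝ) ^ 2)) * Real.exp (-(π * (2 * t) * (b : ℝ) ^ 2)) := by
      rw [← Real.exp_add, ← Real.exp_add]
      congr 1
      push_cast
      ring
    dsimp only
    linear_combination (1 + (-1 : ℝ) ^ (a + b) * (-1 : ℝ) ^ (a - b)) * he +
      Real.exp (-(π * (2 * t) * (a : ℝ) ^ 2)) * Real.exp (-(π * (2 * t) * (b : ℝ) ^ 2)) * hs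
  · rintro ⟨m, n⟩ h
    have hs : (-1 : ℝ) ^ m * (-1 : ℝ) ^ n = -1 := by
      rw [← zpow_add₀ (by norm_num)]
      exact Odd.neg_one_zpow h
    dsimp only
    linear_combination Real.exp (-(π * t * (m : ℝ) ^ 2)) * Real.exp (-(π * t * (n : ℝ) ^ 2)) * hs

lemma thetaThree_mul_thetaFour {t : ℝ} (ht : 0 < t) :
    thetaThree t * thetaFour t = thetaFour (2 * t) ^ 2 := by
  have h3 := summable_exp_neg_mul_int_sq ht
  have h4 := summable_neg_one_zpow_mul_exp ht
  have h42 := summable_neg_one_zpow_mul_exp (t := 2 * t) (by positivity)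
  suffices h : thetaThree t * thetaFour t + thetaFour t * thetaThree t =
      2 * (thetaFour (2 * t) * thetaFour (2 * t)) by linarith
  simp only [thetaThree, thetaFour]
  rw [tsum_mul_tsum_of_summable_norm h3.norm h4.norm,
    tsum_mul_tsum_of_summable_norm h4.norm h3.norm,
    tsum_mul_tsum_of_summable_norm h42.norm h42.norm,
    ← (summable_mul_of_summable_norm h3.norm h4.norm).tsum_add
      (summable_mul_of_summable_norm h4.norm h3.norm), ← tsum_mul_left, tsum_eq_tsum_add_sub]
  · refine tsum_congr fun ⟨a, b⟩ => ?_
    have hp : (-1 : ℝ) ^ (a + b) = (-1 : ℝ) ^ a * (-1 : ℝ) ^ b := zpow_add₀ (by norm_num) _ _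
    have hm : (-1 : ℝ) ^ (a - b) = (-1 : ℝ) ^ a * (-1 : ℝ) ^ b := by
      rw [← hp, show a + b = a - b + 2 * b by ring, zpow_add₀ (by norm_num),
        Even.neg_one_zpow (n := 2 * b) (even_two_mul b), mul_one]
    have he : Real.exp (-(π * t * ((a + b : ℤ) : ℝ) ^ 2)) *
        Real.exp (-(π * t * ((a - b : ℤ) : ℝ) ^ 2)) =
        Real.exp (-(π * (2 * t) * (a : ℝ) ^ 2)) * Real.exp (-(π * (2 * t) * (b : ℝ) ^ 2)) := by
      rw [← Real.exp_add, ← Real.exp_add]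
      congr 1
      push_cast
      ring
    dsimp only
    rw [hp, hm]
    linear_combination 2 * ((-1 : ℝ) ^ a * (-1 : ℝ) ^ b) * he
  · rintro ⟨m, n⟩ h
    have hs : (-1 : ℝ) ^ m + (-1 : ℝ) ^ n = 0 := by
      rcases Int.even_or_odd m with hm | hm <;> rcases Int.even_or_odd n with hn | hn
      · exact absurd (hm.add hn) (Int.not_even_iff_odd.2 h)
      · simp [hm.neg_one_zpow, hn.neg_one_zpow]
      · simp [hm.neg_one_zpow, hn.neg_one_zpow]
      · exact absurd (hm.add_odd hn) (Int.not_even_iff_odd.2 h)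
    dsimp only
    linear_combination Real.exp (-(π * t * (m : ℝ) ^ 2)) * Real.exp (-(π * t * (n : ℝ) ^ 2)) * hs

lemma thetaThree_half_sq : thetaThree (1 / 2) ^ 2 = 2 * thetaThree 2 ^ 2 := by
  have h := Real.tsum_exp_neg_mul_int_sq (a := 1 / 2) (by norm_num)
  have e1 : ∑' n : ℤ, Real.exp (-π * (1 / 2) * (n : ℝ) ^ 2) = thetaThree (1 / 2) :=
    tsum_congr fun n => by ring_nf
  have e2 : ∑' n : ℤ, Real.exp (-π / (1 / 2) * (n : ℝ) ^ 2) = thetaThree 2 :=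
    tsum_congr fun n => by ring_nf
  rw [e1, e2, ← Real.sqrt_eq_rpow] at h
  rw [h, mul_pow, div_pow, Real.sq_sqrt (by norm_num)]
  norm_num

lemma thetaThree_one_sq_eq : thetaThree 1 ^ 2 = √2 * thetaFour 1 ^ 2 := by
  have h1 := thetaThree_sq_add_thetaFour_sq one_pos
  have h2 := thetaThree_sq_add_thetaFour_sq (t := 1 / 2) (by norm_num)
  have h3 := thetaThree_mul_thetaFour (t := 1 / 2) (by norm_num)
  have h4 := thetaThree_half_sq
  norm_num at h1 h2 h3 h4
  have h5 : (thetaThree 1 ^ 2) ^ 2 = (√2 * thetaFour 1 ^ 2) ^ 2 := by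
    rw [mul_pow, Real.sq_sqrt (by norm_num), ← h3, mul_pow]
    have e : thetaThree (1 / 2) ^ 2 = thetaThree 1 ^ 2 + thetaFour 1 ^ 2 := by linarith
    have e' : thetaFour (1 / 2) ^ 2 = thetaThree 1 ^ 2 - thetaFour 1 ^ 2 := by linarith
    have h6 : (thetaFour 1 ^ 2) ^ 2 =
        (thetaThree 1 ^ 2 + thetaFour 1 ^ 2) * (thetaThree 1 ^ 2 - thetaFour 1 ^ 2) := by
      rw [← e, ← e', ← h3, mul_pow]
    rw [e, e']
    linarith
  exact (pow_left_inj₀ (by positivity) (by positivity) two_ne_zero).1 h5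

lemma tendsto_tsum_sign_mul_exp {ε : ℤ → ℝ} (h0 : ε 0 = 1) (hε : ∀ n, ‖ε n‖ = 1) :
    Tendsto (fun t : ℝ => ∑' n : ℤ, ε n * Real.exp (-(π * t * (n : ℝ) ^ 2))) atTop (𝓝 1) := by
  have hlim : ∑' n : ℤ, (if n = 0 then (1 : ℝ) else 0) = 1 := tsum_ite_eq 0 _
  rw [← hlim]
  refine tendsto_tsum_of_dominated_convergence (summable_exp_neg_mul_int_sq one_pos) ?_ ?_
  · intro n
    rcases eq_or_ne n 0 with rfl | hn
    · simp [h0]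
    · rw [if_neg hn, ← mul_zero (ε n)]
      refine (Real.tendsto_exp_atBot.comp ?_).const_mul (ε n)
      refine tendsto_neg_atTop_atBot.comp ?_
      have : (0 : ℝ) < (n : ℝ) ^ 2 := by positivity
      exact (tendsto_id.const_mul_atTop pi_pos).atTop_mul_const this
  · filter_upwards [eventually_ge_atTop 1] with t ht n
    rw [norm_mul, hε, one_mul, Real.norm_eq_abs, Real.abs_exp]
    gcongr

lemma tendsto_thetaThree : Tendsto thetaThree atTop (𝓝 1) := by
  have h := tendsto_tsum_sign_mul_exp (ε := fun _ => 1) rfl (by simp)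
  simp only [one_mul] at h
  exact h

lemma tendsto_thetaFour : Tendsto thetaFour atTop (𝓝 1) :=
  tendsto_tsum_sign_mul_exp (ε := fun n => (-1 : ℝ) ^ n) (by simp) (by simp)

/-! ### The complete elliptic integral and the arithmetic-geometric mean -/

/-- The complete elliptic integral of the first kind, in the form invariant under the
arithmetic-geometric mean iteration. -/
noncomputable def ellipticIntegral (a b : ℝ) : ℝ :=
  ∫ x in Ioi (0 : ℝ), (√((x ^ 2 + a ^ 2) * (x ^ 2 + b ^ 2)))⁻¹

lemma image_sub_div_Ioi {c : ℝ} (hc : 0 < c) :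
    (fun x : ℝ => (x - c / x) / 2) '' Ioi 0 = univ := by
  refine eq_univ_of_forall fun y => ?_
  have h : |y| < √(y ^ 2 + c) := by
    rw [← Real.sqrt_sq_eq_abs]
    exact Real.sqrt_lt_sqrt (sq_nonneg y) (by linarith)
  have hpos : 0 < y + √(y ^ 2 + c) := by linarith [neg_abs_le y]
  have hs := Real.sq_sqrt (show 0 ≤ y ^ 2 + c by positivity)
  refine ⟨y + √(y ^ 2 + c), hpos, ?_⟩
  dsimp only
  field_simp
  linear_combination hs

lemma injOn_sub_div_Ioi {c : ℝ} (hc : 0 < c) :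
    InjOn (fun x : ℝ => (x - c / x) / 2) (Ioi 0) := by
  refine StrictMonoOn.injOn fun x hx y hy hxy => ?_
  have := div_lt_div_of_pos_left hc hx hxy
  linarith

lemma ellipticIntegral_agm {a b g : ℝ} (ha : 0 < a) (hb : 0 < b) (hg : g ^ 2 = a * b) :
    ellipticIntegral ((a + b) / 2) g = ellipticIntegral a b := by
  have hab : 0 < a * b := mul_pos ha hb
  set f : ℝ → ℝ := fun x => (√((x ^ 2 + ((a + b) / 2) ^ 2) * (x ^ 2 + g ^ 2)))⁻¹ with hf
  have hsub : ∫ x, f x = ∫ x in Ioi (0 : ℝ), |(1 + a * b / x ^ 2) / 2| •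
      f ((x - a * b / x) / 2) := by
    rw [← integral_image_eq_integral_abs_deriv_smul measurableSet_Ioi _ (injOn_sub_div_Ioi hab) f,
      image_sub_div_Ioi hab, setIntegral_univ]
    intro x hx
    have hx0 : x ≠ 0 := ne_of_gt hx
    have := ((hasDerivAt_id x).sub ((hasDerivAt_inv hx0).const_mul (a * b))).div_const 2
    refine (this.congr_deriv ?_).hasDerivWithinAt
    field_simp
    ring
  have heven : ∫ x, f x = 2 * ellipticIntegral ((a + b) / 2) g := by
    rw [ellipticIntegral, ← integral_comp_abs (f := f)]
    simp only [hf, sq_abs]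
  have hint : ∫ x in Ioi (0 : ℝ), |(1 + a * b / x ^ 2) / 2| • f ((x - a * b / x) / 2) =
      2 * ellipticIntegral a b := by
    rw [ellipticIntegral, ← integral_const_mul]
    refine setIntegral_congr_fun measurableSet_Ioi fun x hx => ?_
    have hx0 : 0 < x := hx
    have e : (((x - a * b / x) / 2) ^ 2 + ((a + b) / 2) ^ 2) *
        (((x - a * b / x) / 2) ^ 2 + g ^ 2) =
        ((x + a * b / x) / (4 * x)) ^ 2 * ((x ^ 2 + a ^ 2) * (x ^ 2 + b ^ 2)) := by
      rw [hg]
      field_simp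
      ring
    have hpos : 0 < √((x ^ 2 + a ^ 2) * (x ^ 2 + b ^ 2)) := by positivity
    simp only [hf, e, smul_eq_mul]
    rw [Real.sqrt_mul (sq_nonneg _), Real.sqrt_sq (by positivity), abs_of_pos (by positivity)]
    field_simp
    ring
  linarith

lemma ellipticIntegral_mul {a b c : ℝ} (hc : 0 < c) :
    ellipticIntegral (c * a) (c * b) = c⁻¹ * ellipticIntegral a b := by
  have h := integral_comp_mul_left_Ioi
    (fun x : ℝ => (√((x ^ 2 + (c * a) ^ 2) * (x ^ 2 + (c * b) ^ 2)))⁻¹) 0 hc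
  rw [mul_zero, smul_eq_mul] at h
  have e : ∀ x : ℝ, (√(((c * x) ^ 2 + (c * a) ^ 2) * ((c * x) ^ 2 + (c * b) ^ 2)))⁻¹ =
      (c ^ 2)⁻¹ * (√((x ^ 2 + a ^ 2) * (x ^ 2 + b ^ 2)))⁻¹ := fun x => by
    rw [show ((c * x) ^ 2 + (c * a) ^ 2) * ((c * x) ^ 2 + (c * b) ^ 2) =
      (c ^ 2) ^ 2 * ((x ^ 2 + a ^ 2) * (x ^ 2 + b ^ 2)) by ring,
      Real.sqrt_mul (sq_nonneg _), Real.sqrt_sq (by positivity), mul_inv]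
  simp only [e] at h
  rw [integral_const_mul] at h
  simp only [ellipticIntegral]
  field_simp at h ⊢
  linarith

lemma ellipticIntegral_one_one : ellipticIntegral 1 1 = π / 2 := by
  have h := integral_Ioi_inv_one_add_sq (i := 0)
  rw [Real.arctan_zero, sub_zero] at h
  rw [ellipticIntegral, ← h]
  refine setIntegral_congr_fun measurableSet_Ioi fun x _ => ?_
  rw [Real.sqrt_mul_self (by positivity)]
  ring

lemma tendsto_ellipticIntegral {a b : ℕ → ℝ} (ha : Tendsto a atTop (𝓝 1))
    (hb : Tendsto b atTop (𝓝 1)) :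
    Tendsto (fun n => ellipticIntegral (a n) (b n)) atTop (𝓝 (π / 2)) := by
  rw [← ellipticIntegral_one_one]
  have hev : ∀ {u : ℕ → ℝ}, Tendsto u atTop (𝓝 1) → ∀ᶠ n in atTop, 1 / 4 ≤ u n ^ 2 := fun hu =>
    (hu.pow 2).eventually (eventually_ge_nhds (by norm_num))
  refine tendsto_integral_filter_of_dominated_convergence
    (fun x : ℝ => 4 * (1 + x ^ 2)⁻¹) ?_ ?_ ?_ ?_
  · refine Eventually.of_forall fun n => Measurable.aestronglyMeasurable ?_
    fun_prop
  · filter_upwards [hev ha, hev hb] with n hn hn'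
    refine Eventually.of_forall fun x => ?_
    rw [Real.norm_of_nonneg (by positivity), show 4 * (1 + x ^ 2)⁻¹ = ((1 + x ^ 2) / 4)⁻¹ by
      rw [inv_div]; ring]
    refine inv_anti₀ (by positivity) (Real.le_sqrt_of_sq_le ?_)
    rw [sq]
    exact mul_le_mul (by nlinarith) (by nlinarith) (by positivity) (by positivity)
  · exact (integrable_inv_one_add_sq.const_mul 4).integrableOn
  · refine Eventually.of_forall fun x => ?_
    have h : Tendsto (fun n => (x ^ 2 + a n ^ 2) * (x ^ 2 + b n ^ 2)) atTop
        (𝓝 ((x ^ 2 + 1 ^ 2) * (x ^ 2 + 1 ^ 2))) :=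
      ((ha.pow 2).const_add _).mul ((hb.pow 2).const_add _)
    exact h.sqrt.inv₀ (by positivity)

lemma ellipticIntegral_theta {t : ℝ} (ht : 0 < t) (h4 : thetaFour t ≠ 0) :
    ellipticIntegral (thetaThree t ^ 2) (thetaFour t ^ 2) = π / 2 := by
  have step : ∀ n : ℕ, thetaFour (2 ^ n * t) ≠ 0 ∧
      ellipticIntegral (thetaThree (2 ^ n * t) ^ 2) (thetaFour (2 ^ n * t) ^ 2) =
        ellipticIntegral (thetaThree t ^ 2) (thetaFour t ^ 2) := by
    intro n
    induction n with
    | zero => simpa using h4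
    | succ n ih =>
      obtain ⟨hne, hI⟩ := ih
      have hs : 0 < 2 ^ n * t := by positivity
      have h3 := thetaThree_pos hs
      have hadd := thetaThree_sq_add_thetaFour_sq hs
      have hmul := thetaThree_mul_thetaFour hs
      rw [show (2 : ℝ) ^ (n + 1) * t = 2 * (2 ^ n * t) by ring]
      refine ⟨fun h0 => mul_ne_zero h3.ne' hne (by rw [hmul, h0]; norm_num), ?_⟩
      rw [← hI, ← ellipticIntegral_agm (a := thetaThree (2 ^ n * t) ^ 2)
        (g := thetaFour (2 * (2 ^ n * t)) ^ 2) (by positivity) (by positivity)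
        (by rw [← hmul, mul_pow]), hadd]
      congr 1
      ring
  have htop : Tendsto (fun n : ℕ => (2 : ℝ) ^ n * t) atTop atTop :=
    (tendsto_pow_atTop_atTop_of_one_lt one_lt_two).atTop_mul_const ht
  have h3 := (tendsto_thetaThree.comp htop).pow 2
  have h4' := (tendsto_thetaFour.comp htop).pow 2
  rw [one_pow] at h3 h4'
  have hlim := tendsto_ellipticIntegral h3 h4'
  refine tendsto_nhds_unique (tendsto_const_nhds.congr fun n => ?_) hlim
  exact (step n).2.symm

/-! ### The lemniscatic case -/

lemma integral_Ioo_rpow_mul_one_sub_rpow {u v : ℝ} (hu : 0 < u) (hv : 0 < v) :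
    ∫ x in Ioo (0 : ℝ) 1, x ^ (u - 1) * (1 - x) ^ (v - 1) =
      Real.Gamma u * Real.Gamma v / Real.Gamma (u + v) := by
  have h := Complex.betaIntegral_eq_Gamma_mul_div (u : ℂ) (v : ℂ) (by simpa) (by simpa)
  rw [Complex.betaIntegral, intervalIntegral.integral_of_le zero_le_one,
    integral_Ioc_eq_integral_Ioo, ← Complex.ofReal_add, Complex.Gamma_ofReal, Complex.Gamma_ofReal,
    Complex.Gamma_ofReal] at h
  rw [← Complex.ofReal_inj, ← integral_complex_ofReal]
  push_cast
  rw [← h]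
  refine setIntegral_congr_fun measurableSet_Ioo fun x hx => ?_
  rw [Complex.ofReal_cpow hx.1.le, Complex.ofReal_cpow (sub_nonneg.2 hx.2.le)]
  push_cast
  rfl

lemma image_inv_sq_Ioi : (fun x : ℝ => ((1 + x ^ 2) ^ 2)⁻¹) '' Ioi 0 = Ioo 0 1 := by
  ext s
  constructor
  · rintro ⟨x, hx, rfl⟩
    have hx0 : 0 < x := hx
    exact ⟨by positivity, inv_lt_one_of_one_lt₀ (by nlinarith [sq_pos_of_pos hx0])⟩
  · rintro ⟨h0, h1⟩
    have hs : 0 < √s := Real.sqrt_pos.2 h0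
    have hs1 : √s < 1 := (Real.sqrt_lt_sqrt h0.le h1).trans_eq Real.sqrt_one
    have h : 0 < (√s)⁻¹ - 1 := sub_pos.2 ((one_lt_inv₀ hs).2 hs1)
    refine ⟨√((√s)⁻¹ - 1), Real.sqrt_pos.2 h, ?_⟩
    dsimp only
    rw [Real.sq_sqrt h.le, add_sub_cancel, inv_pow, inv_inv, Real.sq_sqrt h0.le]

lemma ellipticIntegral_sqrt_two_one :
    ellipticIntegral (√2) 1 = Real.Gamma (1 / 4) * √π / (4 * Real.Gamma (3 / 4)) := by
  have hB := integral_Ioo_rpow_mul_one_sub_rpow (u := 1 / 4) (v := 1 / 2) (by norm_num)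
    (by norm_num)
  rw [Real.Gamma_one_half_eq, ← image_inv_sq_Ioi,
    integral_image_eq_integral_abs_deriv_smul (f' := fun x => -(4 * x) / (1 + x ^ 2) ^ 3)
      measurableSet_Ioi] at hB
  · have hint : ∫ x in Ioi (0 : ℝ), |-(4 * x) / (1 + x ^ 2) ^ 3| •
        ((((1 + x ^ 2) ^ 2)⁻¹) ^ ((1 : ℝ) / 4 - 1) *
          (1 - ((1 + x ^ 2) ^ 2)⁻¹) ^ ((1 : ℝ) / 2 - 1)) = 4 * ellipticIntegral (√2) 1 := by
      rw [ellipticIntegral, ← integral_const_mul]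
      refine setIntegral_congr_fun measurableSet_Ioi fun x hx => ?_
      have hx0 : 0 < x := hx
      have hw : 0 < 1 + x ^ 2 := by positivity
      have e1 : (((1 + x ^ 2) ^ 2)⁻¹) ^ ((1 : ℝ) / 4 - 1) = (1 + x ^ 2) * √(1 + x ^ 2) := by
        rw [← Real.rpow_natCast, ← Real.rpow_neg hw.le, ← Real.rpow_mul hw.le, Real.sqrt_eq_rpow]
        nth_rw 2 [← Real.rpow_one (1 + x ^ 2)]
        rw [← Real.rpow_add hw]
        norm_num
      have e2 : (1 - ((1 + x ^ 2) ^ 2)⁻¹) ^ ((1 : ℝ) / 2 - 1) =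
          (1 + x ^ 2) / (x * √(x ^ 2 + 2)) := by
        rw [show (1 : ℝ) / 2 - 1 = -(1 / 2) by norm_num,
          show 1 - ((1 + x ^ 2) ^ 2)⁻¹ = (x / (1 + x ^ 2)) ^ 2 * (x ^ 2 + 2) by
            field_simp; ring,
          Real.rpow_neg (by positivity), ← Real.sqrt_eq_rpow, Real.sqrt_mul (sq_nonneg _),
          Real.sqrt_sq (by positivity)]
        field_simp
      have hr := Real.sq_sqrt hw.le
      have hr0 : 0 < √(1 + x ^ 2) := Real.sqrt_pos.2 hw
      have hq : 0 < √(x ^ 2 + 2) := by positivity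
      rw [e1, e2, neg_div, abs_neg, abs_of_pos (by positivity), Real.sq_sqrt (by norm_num),
        Real.sqrt_mul (by positivity), one_pow, add_comm (x ^ 2) 1, smul_eq_mul]
      field_simp
      linear_combination hr
    rw [hint] at hB
    rw [show (1 : ℝ) / 4 + 1 / 2 = 3 / 4 by norm_num] at hB
    rw [mul_comm 4 (Real.Gamma _), ← div_div, ← hB]
    ring
  · intro x _
    have hw : (1 + x ^ 2) ^ 2 ≠ 0 := by positivity
    have := (((hasDerivAt_pow 2 x).const_add 1).fun_pow 2).fun_inv hw
    refine (this.congr_deriv ?_).hasDerivWithinAt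
    have hw' : 1 + x ^ 2 ≠ 0 := by positivity
    field_simp
    push_cast
    ring
  · refine StrictAntiOn.injOn fun x hx y hy hxy => ?_
    have hx0 : 0 < x := hx
    gcongr

lemma Gamma_one_fourth_mul_Gamma_three_fourths :
    Real.Gamma (1 / 4) * Real.Gamma (3 / 4) = √2 * π := by
  have h := Real.Gamma_mul_Gamma_one_sub (1 / 4)
  rw [show (1 : ℝ) - 1 / 4 = 3 / 4 by norm_num, mul_one_div, Real.sin_pi_div_four] at h
  rw [h]
  have := Real.sq_sqrt (show (0 : ℝ) ≤ 2 by norm_num)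
  field_simp
  linear_combination -this

lemma thetaThree_one_sq : thetaThree 1 ^ 2 = √π / Real.Gamma (3 / 4) ^ 2 := by
  have h3 := thetaThree_pos one_pos
  have hrel := thetaThree_one_sq_eq
  have h4 : thetaFour 1 ≠ 0 := fun h => by
    rw [h] at hrel
    have := pow_pos h3 2
    norm_num at hrel
    exact h3.ne' hrel
  have hI := ellipticIntegral_theta one_pos h4
  have hB : 0 < thetaFour 1 ^ 2 := by positivity
  have hmul := ellipticIntegral_mul (a := √2) (b := 1) hB
  rw [mul_one, mul_comm _ (√2), ← hrel, hI, ellipticIntegral_sqrt_two_one] at hmul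
  have hΓ : 0 < Real.Gamma (3 / 4) := Real.Gamma_pos_of_pos (by norm_num)
  have hG := Gamma_one_fourth_mul_Gamma_three_fourths
  have h2 := Real.sq_sqrt (show (0 : ℝ) ≤ 2 by norm_num)
  have hG' : Real.Gamma (1 / 4) = √2 * π / Real.Gamma (3 / 4) := by
    rw [eq_div_iff hΓ.ne', hG]
  rw [hG'] at hmul
  rw [hrel]
  field_simp at hmul ⊢
  linear_combination √2 / 4 * hmul + √π / 2 * h2

theorem theta3_at_i :
    ∑' n : ℤ, Real.exp (-(π * (n : ℝ) ^ 2)) = π ^ ((1 : ℝ) / 4) / Real.Gamma (3 / 4) := by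
  have hθ : ∑' n : ℤ, Real.exp (-(π * (n : ℝ) ^ 2)) = thetaThree 1 := by
    simp only [thetaThree, mul_one]
  have hΓ : 0 < Real.Gamma (3 / 4) := Real.Gamma_pos_of_pos (by norm_num)
  rw [hθ, ← pow_left_inj₀ (thetaThree_pos one_pos).le (by positivity) two_ne_zero,
    thetaThree_one_sq, div_pow, ← Real.rpow_natCast (π ^ _), ← Real.rpow_mul pi_pos.le,
    Real.sqrt_eq_rpow]
  norm_num
end
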